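/- For |q|<1, q³·ψ(q)·ψ(q^{23}) = (1/3)·∑_{j≥1} χ₂₃(j)·( q^j/(1−q^j) − q^{2j}/(1−q^{2j}) ) − (1/3)·η₁η₂₃ − (2/3)·η₂η₄₆, where χ₂₃ is the Legendre symbol mod 23, η₁η₂₃ = q·∏_{n≥1}(1−q^n)(1−q^{23n}) and η₂η₄₆ = q²·∏_{n≥1}(1−q^{2n})(1−q^{46n}). -/

import Mathlib

noncomputable section

instance : Fact (Nat.Prime 23) := ⟨by norm_num⟩

/-- The set of representations of `n` by the binary quadratic form `a x² + b x y + c y²`. -/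
def repSet (a b c n : ℤ) : Set (ℤ × ℤ) :=
  {v | a * v.1 ^ 2 + b * v.1 * v.2 + c * v.2 ^ 2 = n}

/-- The number of representations of `n` by the binary quadratic form `a x² + b x y + c y²`. -/
def repCount (a b c n : ℤ) : ℕ := (repSet a b c n).ncard

lemma ncard_eq_of_equiv (e : ℤ × ℤ ≃ ℤ × ℤ) {s t : Set (ℤ × ℤ)} (h : ∀ v, v ∈ s ↔ e v ∈ t) :
    s.ncard = t.ncard :=
  Nat.card_congr (e.subtypeEquiv h)

lemma ncard_eq_of_parametrization {s t : Set (ℤ × ℤ)} (f : ℤ × ℤ → ℤ × ℤ)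
    (hf : Function.Injective f) (h : ∀ v, v ∈ s ↔ f v ∈ t) (hsurj : ∀ w ∈ t, ∃ v, f v = w) :
    s.ncard = t.ncard := by
  rw [← Set.ncard_image_of_injective s hf]
  congr 1
  ext w
  constructor
  · rintro ⟨v, hv, rfl⟩
    exact (h v).1 hv
  · intro hw
    obtain ⟨v, rfl⟩ := hsurj w hw
    exact ⟨v, (h v).2 hw, rfl⟩

lemma repSet_finite {a b c : ℤ} (ha : 0 < a) (hd : b ^ 2 - 4 * a * c = -23) (n : ℤ) :
    (repSet a b c n).Finite := by
  have hc : 0 < c := by nlinarith [sq_nonneg b]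
  refine (Set.finite_Icc ((-(4 * c * n), -(4 * a * n)) : ℤ × ℤ) (4 * c * n, 4 * a * n)).subset ?_
  rintro ⟨x, y⟩ h
  simp only [repSet, Set.mem_ofPred_eq] at h
  have hx : x ^ 2 ≤ 4 * c * n := by
    have : 4 * c * n = (2 * c * y + b * x) ^ 2 + 23 * x ^ 2 := by
      linear_combination (-4 * c) * h - x ^ 2 * hd
    nlinarith [sq_nonneg (2 * c * y + b * x), sq_nonneg x]
  have hy : y ^ 2 ≤ 4 * a * n := by
    have : 4 * a * n = (2 * a * x + b * y) ^ 2 + 23 * y ^ 2 := by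
      linear_combination (-4 * a) * h - y ^ 2 * hd
    nlinarith [sq_nonneg (2 * a * x + b * y), sq_nonneg y]
  have aux (z : ℤ) : z ≤ z ^ 2 ∧ -z ≤ z ^ 2 := by
    constructor
    · exact Int.le_self_sq z
    · simpa using Int.le_self_sq (-z)
  simp only [Set.mem_Icc, Prod.mk_le_mk]
  have := aux x
  have := aux y
  omega

lemma repCount_translate (a b c k n : ℤ) :
    repCount a b c n = repCount a (b + 2 * a * k) (a * k ^ 2 + b * k + c) n := by
  refine ncard_eq_of_equiv
    ⟨fun v ↦ (v.1 - k * v.2, v.2), fun v ↦ (v.1 + k * v.2, v.2), fun v ↦ by simp, fun v ↦ by simp⟩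
    fun v ↦ ?_
  simp only [repSet, Set.mem_ofPred_eq, Equiv.coe_fn_mk]
  ring_nf

lemma repCount_swap (a b c n : ℤ) : repCount a b c n = repCount c b a n := by
  refine ncard_eq_of_equiv (Equiv.prodComm ℤ ℤ) fun v ↦ ?_
  simp only [repSet, Set.mem_ofPred_eq, Equiv.prodComm_apply, Prod.fst_swap, Prod.snd_swap]
  ring_nf

lemma repCount_neg (a b c n : ℤ) : repCount a b c n = repCount a (-b) c n := by
  refine ncard_eq_of_equiv ((Equiv.neg ℤ).prodCongr (Equiv.refl ℤ)) fun v ↦ ?_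
  simp [repSet]

/-- Reduction theory: up to equivalence, there are only two positive definite
binary quadratic forms of discriminant `-23`. -/
lemma repCount_eq_or (a : ℕ) (b c : ℤ) (ha : 0 < a) (hd : b ^ 2 - 4 * a * c = -23) :
    repCount a b c = repCount 1 1 6 ∨ repCount a b c = repCount 2 1 3 := by
  induction a using Nat.strong_induction_on generalizing b c with
  | _ a ih =>
  obtain ⟨k, hk₁, hk₂⟩ : ∃ k : ℤ, -a ≤ b + 2 * a * k ∧ b + 2 * a * k ≤ a := by
    refine ⟨-((b + a) / (2 * a)), ?_⟩
    have h1 := Int.emod_add_mul_ediv (b + a) (2 * a)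
    have h2 := Int.emod_nonneg (b + a) (b := 2 * a) (by positivity)
    have h3 := Int.emod_lt_of_pos (b + a) (b := 2 * a) (by positivity)
    constructor <;> linarith
  have htrans : repCount a b c = repCount a (b + 2 * a * k) (a * k ^ 2 + b * k + c) :=
    funext fun n ↦ repCount_translate a b c k n
  rw [htrans]
  have hd' : (b + 2 * a * k) ^ 2 - 4 * a * (a * k ^ 2 + b * k + c) = -23 := by
    linear_combination hd
  generalize b + 2 * a * k = b' at *
  generalize a * k ^ 2 + b * k + c = c' at *
  have ha' : (0 : ℤ) < a := by exact_mod_cast ha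
  have hc' : 0 < c' := by nlinarith [sq_nonneg b']
  obtain hlt | hle := lt_or_ge c' a
  · lift c' to ℕ using hc'.le
    rw [funext fun n ↦ repCount_swap a b' c' n]
    exact ih c' (by exact_mod_cast hlt) b' a (by exact_mod_cast hc') (by linarith)
  · have ha2 : (a : ℤ) ≤ 2 := by nlinarith
    have hneg (x y z : ℤ) : repCount x (-y) z = repCount x y z :=
      funext fun n ↦ (repCount_neg x y z n).symm
    generalize (a : ℤ) = A at *
    interval_cases A
    · left
      have : b' = 1 ∨ b' = -1 ∨ b' = 0 := by omega
      rcases this with rfl | rfl | rfl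
      · rw [show c' = 6 by linarith]
      · rw [show c' = 6 by linarith, hneg]
      · omega
    · right
      have : b' = 1 ∨ b' = -1 ∨ b' = 0 ∨ b' = 2 ∨ b' = -2 := by omega
      rcases this with rfl | rfl | rfl | rfl | rfl
      · rw [show c' = 3 by linarith]
      · rw [show c' = 3 by linarith, hneg]
      all_goals omega

/-- The Hecke relation at a prime `p` modulo which the form splits into distinct linear factors. -/
lemma repCount_prime_mul_add {a b c : ℤ} (ha : 0 < a) (hd : b ^ 2 - 4 * a * c = -23) {p : ℕ}
    (hp : p.Prime) (hpa : ¬ (p : ℤ) ∣ a) {t₁ t₂ d₁ d₂ : ℤ}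
    (h₁ : a * t₁ ^ 2 + b * t₁ + c = p * d₁) (h₂ : a * t₂ ^ 2 + b * t₂ + c = p * d₂)
    (h₁₂ : ¬ (p : ℤ) ∣ t₁ - t₂) (n : ℤ) :
    repCount a b c (p * n) + repCount (p * a) (p * b) (p * c) n
      = repCount (a * p) (2 * a * t₁ + b) d₁ n + repCount (a * p) (2 * a * t₂ + b) d₂ n := by
  have hp' : Prime (p : ℤ) := Nat.prime_iff_prime_int.1 hp
  have hp0 : (p : ℤ) ≠ 0 := hp'.ne_zero
  have key (t d : ℤ) (h : a * t ^ 2 + b * t + c = p * d) :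
      repCount (a * p) (2 * a * t + b) d n =
        (repSet a b c (p * n) ∩ {v | (p : ℤ) ∣ v.1 - t * v.2}).ncard := by
    refine ncard_eq_of_parametrization (fun v ↦ (t * v.2 + p * v.1, v.2)) ?_ ?_ ?_
    · rintro ⟨x, y⟩ ⟨x', y'⟩ h
      simp only [Prod.mk.injEq] at h ⊢
      obtain ⟨h, rfl⟩ := h
      exact ⟨mul_left_cancel₀ hp0 (by linarith), rfl⟩
    · rintro ⟨x, y⟩
      simp only [repSet, Set.mem_ofPred_eq, Set.mem_inter_iff, add_sub_cancel_left, dvd_mul_right,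
        and_true]
      rw [← mul_right_inj' hp0 (b := _ + _)]
      constructor <;> intro h'
      · linear_combination h' + y ^ 2 * h
      · linear_combination h' - y ^ 2 * h
    · rintro ⟨x, y⟩ ⟨-, z, hz⟩
      exact ⟨(z, y), by simp only [Prod.mk.injEq, and_true] at hz ⊢; linarith⟩
  have hsum : (p : ℤ) ∣ a * (t₁ + t₂) + b := by
    have : (p : ℤ) ∣ (t₁ - t₂) * (a * (t₁ + t₂) + b) := ⟨d₁ - d₂, by linear_combination h₁ - h₂⟩
    exact (hp'.dvd_or_dvd this).resolve_left h₁₂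
  rw [key t₁ d₁ h₁, key t₂ d₂ h₂, ← Set.ncard_union_add_ncard_inter _ _
    ((repSet_finite ha hd _).subset Set.inter_subset_left)
    ((repSet_finite ha hd _).subset Set.inter_subset_left)]
  congr 1
  · rw [← Set.inter_union_distrib_left, repCount]
    congr 1
    refine (Set.inter_eq_left.2 fun v hv ↦ ?_).symm
    obtain ⟨e, he⟩ := hsum
    have hdvd : (p : ℤ) ∣ a * ((v.1 - t₁ * v.2) * (v.1 - t₂ * v.2)) := by
      refine ⟨n - e * v.1 * v.2 - d₁ * v.2 ^ 2 + t₁ * e * v.2 ^ 2, ?_⟩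
      simp only [repSet, Set.mem_ofPred_eq] at hv
      linear_combination hv - v.1 * v.2 * he - v.2 ^ 2 * h₁ + t₁ * v.2 ^ 2 * he
    exact hp'.dvd_or_dvd ((hp'.dvd_or_dvd hdvd).resolve_left hpa)
  · refine ncard_eq_of_parametrization (fun v ↦ (p * v.1, p * v.2)) ?_ ?_ ?_
    · rintro ⟨x, y⟩ ⟨x', y'⟩ h
      simpa [hp.ne_zero] using h
    · rintro ⟨x, y⟩
      simp only [repSet, Set.mem_ofPred_eq, Set.mem_inter_iff]
      rw [← mul_right_inj' hp0 (c := n)]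
      constructor
      · intro h
        refine ⟨⟨by linear_combination h, ⟨x - t₁ * y, by ring⟩⟩, by linear_combination h,
          ⟨x - t₂ * y, by ring⟩⟩
      · rintro ⟨⟨h, -⟩, -⟩
        linear_combination h
    · rintro ⟨x, y⟩ ⟨⟨-, hx₁⟩, -, hx₂⟩
      simp only [Set.mem_ofPred_eq] at hx₁ hx₂
      have : (p : ℤ) ∣ (t₁ - t₂) * y := by
        have h := dvd_sub hx₂ hx₁
        rwa [show x - t₂ * y - (x - t₁ * y) = (t₁ - t₂) * y by ring] at h
      obtain ⟨y', rfl⟩ := (hp'.dvd_or_dvd this).resolve_left h₁₂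
      obtain ⟨x', rfl⟩ : (p : ℤ) ∣ x := by
        simpa using dvd_add hx₁ (dvd_mul_of_dvd_right (dvd_mul_right (p : ℤ) y') t₁)
      exact ⟨(x', y'), rfl⟩

lemma exists_roots_of_isSquare {a b c : ℤ} (hd : b ^ 2 - 4 * a * c = -23) {p : ℕ} [Fact p.Prime]
    (hp2 : p ≠ 2) (hp23 : p ≠ 23) (hpa : ¬ (p : ℤ) ∣ a) (hsq : IsSquare (-23 : ZMod p)) :
    ∃ t₁ t₂ d₁ d₂ : ℤ, a * t₁ ^ 2 + b * t₁ + c = p * d₁ ∧ a * t₂ ^ 2 + b * t₂ + c = p * d₂ ∧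
      ¬ (p : ℤ) ∣ t₁ - t₂ := by
  obtain ⟨s, hs⟩ := hsq
  have h2 : (2 : ZMod p) ≠ 0 := by
    intro h
    have := (ZMod.natCast_eq_zero_iff 2 p).1 (by exact_mod_cast h)
    exact hp2 ((Nat.prime_dvd_prime_iff_eq Fact.out Nat.prime_two).1 this)
  have h23 : (23 : ZMod p) ≠ 0 := by
    intro h
    have := (ZMod.natCast_eq_zero_iff 23 p).1 (by exact_mod_cast h)
    exact hp23 ((Nat.prime_dvd_prime_iff_eq Fact.out (by norm_num)).1 this)
  have ha : (a : ZMod p) ≠ 0 := by rwa [Ne, ZMod.intCast_zmod_eq_zero_iff_dvd]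
  have hs0 : s ≠ 0 := by
    rintro rfl
    exact h23 (by linear_combination -hs)
  have hd' : (b : ZMod p) ^ 2 - 4 * a * c = -23 := by
    exact_mod_cast congrArg (Int.cast (R := ZMod p)) hd
  obtain ⟨t₁, ht₁⟩ := ZMod.intCast_surjective ((-b + s) / (2 * a) : ZMod p)
  obtain ⟨t₂, ht₂⟩ := ZMod.intCast_surjective ((-b - s) / (2 * a) : ZMod p)
  have hroot (t : ℤ) (s' : ZMod p) (hs' : -23 = s' * s') (ht : (t : ZMod p) = (-b + s') / (2 * a)) :
      (p : ℤ) ∣ a * t ^ 2 + b * t + c := by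
    rw [← ZMod.intCast_zmod_eq_zero_iff_dvd]
    push_cast
    rw [ht]
    field_simp
    linear_combination -hs' - hd'
  obtain ⟨d₁, hd₁⟩ := hroot t₁ s hs ht₁
  obtain ⟨d₂, hd₂⟩ := hroot t₂ (-s) (by rw [hs]; ring) (by rw [ht₂]; ring)
  refine ⟨t₁, t₂, d₁, d₂, hd₁, hd₂, ?_⟩
  rw [← ZMod.intCast_zmod_eq_zero_iff_dvd]
  push_cast
  rw [ht₁, ht₂, ← sub_div, div_eq_zero_iff, not_or]
  refine ⟨fun h ↦ ?_, mul_ne_zero h2 ha⟩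
  have : (2 : ZMod p) * s = 0 := by linear_combination h
  exact (mul_ne_zero h2 hs0) this

lemma repCount_prime_mul_arg {p : ℕ} (hp : p.Prime) (a b c n : ℤ) :
    repCount (p * a) (p * b) (p * c) (p * n) = repCount a b c n := by
  have hp0 : (p : ℤ) ≠ 0 := by exact_mod_cast hp.ne_zero
  rw [repCount, repCount]
  congr 1
  ext v
  simp only [repSet, Set.mem_ofPred_eq]
  rw [← mul_right_inj' hp0 (c := n)]
  ring_nf

lemma repCount_prime_mul_of_not_dvd {p : ℕ} {n : ℤ} (h : ¬ (p : ℤ) ∣ n) (a b c : ℤ) :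
    repCount (p * a) (p * b) (p * c) n = 0 := by
  rw [repCount, show repSet (p * a) (p * b) (p * c) n = ∅ from ?_, Set.ncard_empty]
  refine Set.eq_empty_of_forall_notMem fun ⟨x, y⟩ hv ↦ h ?_
  simp only [repSet, Set.mem_ofPred_eq] at hv
  exact ⟨a * x ^ 2 + b * x * y + c * y ^ 2, by linear_combination -hv⟩

lemma repCount_twenty_three_mul {a b c : ℤ} (hd : b ^ 2 - 4 * a * c = -23) (n : ℤ) :
    repCount a b c (23 * n) = repCount a b c n := by
  refine (ncard_eq_of_parametrization
    (fun v ↦ (-(b * v.1 + 2 * c * v.2), 2 * a * v.1 + b * v.2)) ?_ ?_ ?_).symm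
  · rintro ⟨x, y⟩ ⟨x', y'⟩ h
    simp only [Prod.mk.injEq] at h ⊢
    obtain ⟨h₁, h₂⟩ := h
    constructor
    · linarith [show 23 * (x - x') = 0 by
        linear_combination b * h₁ + 2 * c * h₂ + (x - x') * hd]
    · linarith [show 23 * (y - y') = 0 by
        linear_combination -2 * a * h₁ - b * h₂ + (y - y') * hd]
  · rintro ⟨x, y⟩
    simp only [repSet, Set.mem_ofPred_eq]
    constructor <;> intro h
    · linear_combination 23 * h - (a * x ^ 2 + b * x * y + c * y ^ 2) * hd
    · have : (23 : ℤ) * (a * x ^ 2 + b * x * y + c * y ^ 2 - n) = 0 := by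
        linear_combination h + (a * x ^ 2 + b * x * y + c * y ^ 2) * hd
      linarith
  · rintro ⟨x, y⟩ h
    simp only [repSet, Set.mem_ofPred_eq] at h
    have h23 : Prime (23 : ℤ) := Nat.prime_iff_prime_int.1 (by norm_num)
    obtain ⟨x', hx'⟩ : (23 : ℤ) ∣ b * x + 2 * c * y := h23.dvd_of_dvd_pow (n := 2)
      ⟨4 * c * n - x ^ 2, by linear_combination 4 * c * h + x ^ 2 * hd⟩
    obtain ⟨y', hy'⟩ : (23 : ℤ) ∣ 2 * a * x + b * y := h23.dvd_of_dvd_pow (n := 2)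
      ⟨4 * a * n - y ^ 2, by linear_combination 4 * a * h + y ^ 2 * hd⟩
    refine ⟨(x', -y'), ?_⟩
    simp only [Prod.mk.injEq]
    constructor
    · linarith [show 23 * (-(b * x' + 2 * c * -y') - x) = 0 by
        linear_combination b * hx' - 2 * c * hy' - x * hd]
    · linarith [show 23 * (2 * a * x' + b * -y' - y) = 0 by
        linear_combination -2 * a * hx' + b * hy' - y * hd]

lemma repCount_inert_mul {a b c : ℤ} (hd : b ^ 2 - 4 * a * c = -23) {p : ℕ} [Fact p.Prime]
    (hp2 : p ≠ 2) (hpa : ¬ (p : ℤ) ∣ a) (hsq : ¬ IsSquare (-23 : ZMod p)) (n : ℤ) :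
    repCount a b c (p * n) = repCount (p * a) (p * b) (p * c) n := by
  have hp : p.Prime := Fact.out
  have hp' : Prime (p : ℤ) := Nat.prime_iff_prime_int.1 hp
  have hp0 : (p : ℤ) ≠ 0 := hp'.ne_zero
  refine (ncard_eq_of_parametrization (fun v ↦ (p * v.1, p * v.2)) ?_ ?_ ?_).symm
  · rintro ⟨x, y⟩ ⟨x', y'⟩ h
    simpa [hp.ne_zero] using h
  · rintro ⟨x, y⟩
    simp only [repSet, Set.mem_ofPred_eq]
    rw [← mul_right_inj' hp0 (c := n)]
    ring_nf
  · rintro ⟨x, y⟩ h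
    simp only [repSet, Set.mem_ofPred_eq] at h
    have hp2' : ¬ (p : ℤ) ∣ 2 := fun h ↦
      hp2 ((Nat.prime_dvd_prime_iff_eq hp Nat.prime_two).1 (by exact_mod_cast h))
    have hsq0 : ((2 * a * x + b * y : ℤ) : ZMod p) ^ 2 = -23 * (y : ZMod p) ^ 2 := by
      have h' : (2 * a * x + b * y) ^ 2 + 23 * y ^ 2 = p * (4 * a * n) := by
        linear_combination 4 * a * h + y ^ 2 * hd
      have := congrArg (Int.cast (R := ZMod p)) h'
      push_cast at this ⊢
      rw [CharP.cast_eq_zero, zero_mul] at this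
      linear_combination this
    have hy0 : (y : ZMod p) = 0 := by
      by_contra hy
      refine hsq ⟨(2 * a * x + b * y : ℤ) / (y : ZMod p), ?_⟩
      field_simp
      rw [hsq0]
      ring
    have hy := (ZMod.intCast_zmod_eq_zero_iff_dvd y p).1 hy0
    have hx : (p : ℤ) ∣ 2 * a * x + b * y := by
      rw [← ZMod.intCast_zmod_eq_zero_iff_dvd]
      rw [hy0, zero_pow two_ne_zero, mul_zero] at hsq0
      exact pow_eq_zero_iff two_ne_zero |>.1 hsq0
    obtain ⟨x', rfl⟩ : (p : ℤ) ∣ x := by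
      have := (dvd_add_left (dvd_mul_of_dvd_right hy b)).1 hx
      exact (hp'.dvd_or_dvd this).resolve_left fun h ↦ (hp'.dvd_or_dvd h).elim hp2' hpa
    obtain ⟨y', rfl⟩ := hy
    exact ⟨(x', y'), rfl⟩

lemma repCount_one_one_six_one : repCount 1 1 6 1 = 2 := by
  rw [repCount, show repSet 1 1 6 1 = {(1, 0), (-1, 0)} from ?_, Set.ncard_pair (by simp)]
  ext ⟨x, y⟩
  simp only [repSet, Set.mem_ofPred_eq, Set.mem_insert_iff, Set.mem_singleton_iff, Prod.mk.injEq]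
  constructor
  · intro h
    have hy : y = 0 := by
      have : y ^ 2 < 1 := by nlinarith [sq_nonneg (2 * x + y)]
      exact pow_eq_zero_iff two_ne_zero |>.1 (by nlinarith [sq_nonneg y])
    subst hy
    rcases mul_eq_zero.1 (show (x - 1) * (x + 1) = 0 by linarith) with h | h <;> omega
  · rintro (⟨rfl, rfl⟩ | ⟨rfl, rfl⟩) <;> norm_num

lemma repCount_two_one_three_two : repCount 2 1 3 2 = 2 := by
  rw [repCount, show repSet 2 1 3 2 = {(1, 0), (-1, 0)} from ?_, Set.ncard_pair (by simp)]
  ext ⟨x, y⟩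
  simp only [repSet, Set.mem_ofPred_eq, Set.mem_insert_iff, Set.mem_singleton_iff, Prod.mk.injEq]
  constructor
  · intro h
    have hy : y = 0 := by
      have : y ^ 2 < 1 := by nlinarith [sq_nonneg (4 * x + y)]
      exact pow_eq_zero_iff two_ne_zero |>.1 (by nlinarith [sq_nonneg y])
    subst hy
    rcases mul_eq_zero.1 (show (x - 1) * (x + 1) = 0 by linarith) with h | h <;> omega
  · rintro (⟨rfl, rfl⟩ | ⟨rfl, rfl⟩) <;> norm_num

lemma repCount_one_one_six_two : repCount 1 1 6 2 = 0 := by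
  rw [repCount, show repSet 1 1 6 2 = ∅ from ?_, Set.ncard_empty]
  refine Set.eq_empty_of_forall_notMem fun ⟨x, y⟩ h ↦ ?_
  simp only [repSet, Set.mem_ofPred_eq] at h
  have hy : y = 0 := by
    have : y ^ 2 < 1 := by nlinarith [sq_nonneg (2 * x + y)]
    exact pow_eq_zero_iff two_ne_zero |>.1 (by nlinarith [sq_nonneg y])
  subst hy
  have : x < 2 := by nlinarith
  have : -2 < x := by nlinarith
  interval_cases x <;> omega

lemma repCount_two_one_three_one : repCount 2 1 3 1 = 0 := by
  rw [repCount, show repSet 2 1 3 1 = ∅ from ?_, Set.ncard_empty]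
  refine Set.eq_empty_of_forall_notMem fun ⟨x, y⟩ h ↦ ?_
  simp only [repSet, Set.mem_ofPred_eq] at h
  have hy : y = 0 := by
    have : y ^ 2 < 1 := by nlinarith [sq_nonneg (4 * x + y)]
    exact pow_eq_zero_iff two_ne_zero |>.1 (by nlinarith [sq_nonneg y])
  subst hy
  omega

lemma repCount_one_one_six_two_mul (n : ℤ) :
    repCount 1 1 6 (2 * n) + repCount 2 2 12 n = 2 * repCount 2 1 3 n := by
  have := repCount_prime_mul_add (a := 1) (b := 1) (c := 6) (by norm_num) (by norm_num)
    Nat.prime_two (by norm_num) (t₁ := 0) (t₂ := -1) (d₁ := 3) (d₂ := 3) (by norm_num)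
    (by norm_num) (by norm_num) n
  norm_num at this
  rw [this, ← repCount_neg 2 1 3, two_mul]

lemma repCount_two_one_three_two_mul (n : ℤ) :
    repCount 2 1 3 (2 * n) + repCount 4 2 6 n = repCount 1 1 6 n + repCount 2 1 3 n := by
  have := repCount_prime_mul_add (a := 3) (b := 1) (c := 2) (by norm_num) (by norm_num)
    Nat.prime_two (by norm_num) (t₁ := 0) (t₂ := 1) (d₁ := 1) (d₂ := 3) (by norm_num)
    (by norm_num) (by norm_num) n
  norm_num at this
  have h := repCount_translate 6 7 3 (-1) n
  norm_num at h
  have h' := repCount_translate 2 (-5) 6 1 n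
  norm_num at h'
  rw [repCount_swap 2 1 3, repCount_swap 4 2 6, this, repCount_swap 6 1 1, h, repCount_swap 6 (-5),
    h', ← repCount_neg 2 1 3]

/-- The number of representations of `n` by a full system of three inequivalent
forms of discriminant `-23`. -/
def totalRepCount (n : ℤ) : ℕ := repCount 1 1 6 n + 2 * repCount 2 1 3 n

lemma totalRepCount_one : totalRepCount 1 = 2 := by
  rw [totalRepCount, repCount_one_one_six_one, repCount_two_one_three_one]

lemma totalRepCount_split {p : ℕ} [Fact p.Prime] (hp2 : p ≠ 2) (hp23 : p ≠ 23)
    (hsq : IsSquare (-23 : ZMod p)) (n : ℤ) :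
    totalRepCount (p * n) + (repCount (p * 1) (p * 1) (p * 6) n
      + 2 * repCount (p * 2) (p * 1) (p * 3) n) =
      2 * totalRepCount n := by
  have hp : p.Prime := Fact.out
  have hp' : Prime (p : ℤ) := Nat.prime_iff_prime_int.1 hp
  have hp1 : ¬ (p : ℤ) ∣ 1 := hp'.not_dvd_one
  have hp2' : ¬ (p : ℤ) ∣ 2 := fun h ↦
    hp2 ((Nat.prime_dvd_prime_iff_eq hp Nat.prime_two).1 (by exact_mod_cast h))
  have h2p : ¬ ((2 : ℕ) : ℤ) ∣ p := fun h ↦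
    hp2 ((Nat.prime_dvd_prime_iff_eq Nat.prime_two hp).1 (by exact_mod_cast h)).symm
  obtain ⟨t₁, t₂, d₁, d₂, h₁, h₂, h₁₂⟩ := exists_roots_of_isSquare (a := 1) (b := 1) (c := 6)
    (by norm_num) hp2 hp23 hp1 hsq
  obtain ⟨s₁, s₂, e₁, e₂, k₁, k₂, k₁₂⟩ := exists_roots_of_isSquare (a := 2) (b := 1) (c := 3)
    (by norm_num) hp2 hp23 hp2' hsq
  have H := repCount_prime_mul_add (by norm_num) (by norm_num) hp hp1 h₁ h₂ h₁₂
  have K := repCount_prime_mul_add (by norm_num) (by norm_num) hp hp2' k₁ k₂ k₁₂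
  have c₁ := repCount_eq_or (1 * p) (2 * 1 * t₁ + 1) d₁ (by simp [hp.pos])
    (by push_cast; linear_combination 4 * h₁)
  have c₂ := repCount_eq_or (1 * p) (2 * 1 * t₂ + 1) d₂ (by simp [hp.pos])
    (by push_cast; linear_combination 4 * h₂)
  have c₃ := repCount_eq_or (2 * p) (2 * 2 * s₁ + 1) e₁ (by simp [hp.pos])
    (by push_cast; linear_combination 8 * k₁)
  have c₄ := repCount_eq_or (2 * p) (2 * 2 * s₂ + 1) e₂ (by simp [hp.pos])
    (by push_cast; linear_combination 8 * k₂)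
  have H2 := H 2
  have K1 := K 1
  have T := repCount_one_one_six_two_mul p
  have T0 := repCount_prime_mul_of_not_dvd h2p 1 1 6
  rw [repCount_prime_mul_of_not_dvd hp2'] at H2
  rw [repCount_prime_mul_of_not_dvd hp1, mul_one] at K1
  norm_num at T0
  rw [T0, mul_comm] at T
  have Hn := H n
  have Kn := K n
  have v₁ := repCount_one_one_six_one
  have v₂ := repCount_one_one_six_two
  have v₃ := repCount_two_one_three_one
  have v₄ := repCount_two_one_three_two
  clear H K
  simp only [Nat.cast_mul, Nat.cast_one, Nat.cast_ofNat] at c₁ c₂ c₃ c₄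
  simp only [totalRepCount]
  rcases c₁ with c₁ | c₁ <;> rcases c₂ with c₂ | c₂ <;> rcases c₃ with c₃ | c₃ <;>
    rcases c₄ with c₄ | c₄ <;> rw [c₁, c₂] at H2 Hn <;> rw [c₃, c₄] at K1 Kn <;> omega

lemma legendreSym_neg_twenty_three {p : ℕ} [Fact p.Prime] (hp2 : p ≠ 2) :
    legendreSym p (-23) = legendreSym 23 p := by
  have hodd : p % 2 = 1 := (Nat.Prime.eq_two_or_odd Fact.out).resolve_left hp2
  rw [show (-23 : ℤ) = -1 * (23 : ℕ) by norm_num, legendreSym.mul, legendreSym.at_neg_one hp2,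
    ZMod.χ₄_eq_neg_one_pow hodd, legendreSym.quadratic_reciprocity' hp2 (q := 23) (by norm_num),
    mul_comm (p / 2), pow_mul]
  norm_num

/-- The Hecke relation for the theta series attached to `totalRepCount`. -/
lemma totalRepCount_prime_mul {p : ℕ} (hp : p.Prime) (n : ℤ) :
    (totalRepCount (p * n) : ℤ) + legendreSym 23 p *
      (repCount (p * 1) (p * 1) (p * 6) n + 2 * repCount (p * 2) (p * 1) (p * 3) n : ℕ) =
      (1 + legendreSym 23 p) * totalRepCount n := by
  have := Fact.mk hp
  obtain rfl | hp2 := eq_or_ne p 2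
  · have h₁ := repCount_one_one_six_two_mul n
    have h₂ := repCount_two_one_three_two_mul n
    rw [show legendreSym 23 (2 : ℕ) = 1 by norm_num]
    norm_num [totalRepCount]
    omega
  obtain rfl | hp23 := eq_or_ne p 23
  · rw [show legendreSym 23 (23 : ℕ) = 0 by norm_num]
    simp [totalRepCount, repCount_twenty_three_mul (a := 1) (b := 1) (c := 6) (by norm_num),
      repCount_twenty_three_mul (a := 2) (b := 1) (c := 3) (by norm_num)]
  have hp' : Prime (p : ℤ) := Nat.prime_iff_prime_int.1 hp
  have hne : ((-23 : ℤ) : ZMod p) ≠ 0 := by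
    rw [Ne, ZMod.intCast_zmod_eq_zero_iff_dvd, dvd_neg]
    exact fun h ↦ hp23 ((Nat.prime_dvd_prime_iff_eq hp (by norm_num)).1 (by exact_mod_cast h))
  rw [← legendreSym_neg_twenty_three hp2]
  have hcast : ((-23 : ℤ) : ZMod p) = -23 := by norm_cast
  obtain h | h := legendreSym.eq_one_or_neg_one p hne
  · have := totalRepCount_split hp2 hp23 (hcast ▸ (legendreSym.eq_one_iff p hne).1 h) n
    rw [h]
    omega
  · have hsq := hcast ▸ (legendreSym.eq_neg_one_iff p).1 h
    have hp2' : ¬ (p : ℤ) ∣ 2 := fun h ↦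
      hp2 ((Nat.prime_dvd_prime_iff_eq hp Nat.prime_two).1 (by exact_mod_cast h))
    rw [h, totalRepCount, repCount_inert_mul (by norm_num) hp2 hp'.not_dvd_one hsq,
      repCount_inert_mul (by norm_num) hp2 hp2' hsq]
    omega

/-- The divisor sum of the quadratic character modulo `23`. -/
def charDivisorSum (n : ℕ) : ℤ := ∑ d ∈ n.divisors, legendreSym 23 d

lemma charDivisorSum_prime_mul_add {p m : ℕ} (hp : p.Prime) (hm : m ≠ 0) :
    charDivisorSum (p * m) + ∑ d ∈ m.divisors ∩ m.divisors.image (p * ·), legendreSym 23 d =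
      (1 + legendreSym 23 p) * charDivisorSum m := by
  have hunion : (p * m).divisors = m.divisors ∪ m.divisors.image (p * ·) := by
    ext d
    simp only [Nat.mem_divisors, Finset.mem_union, Finset.mem_image]
    constructor
    · rintro ⟨hd, -⟩
      by_cases hpd : p ∣ d
      · obtain ⟨e, rfl⟩ := hpd
        exact Or.inr ⟨e, ⟨Nat.dvd_of_mul_dvd_mul_left hp.pos hd, hm⟩, rfl⟩
      · exact Or.inl ⟨((hp.coprime_iff_not_dvd.2 hpd).symm).dvd_of_dvd_mul_left hd, hm⟩
    · rintro (⟨hd, -⟩ | ⟨e, ⟨he, -⟩, rfl⟩)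
      · exact ⟨dvd_mul_of_dvd_right hd p, mul_ne_zero hp.ne_zero hm⟩
      · exact ⟨Nat.mul_dvd_mul_left p he, mul_ne_zero hp.ne_zero hm⟩
  rw [charDivisorSum, hunion, Finset.sum_union_inter,
    Finset.sum_image fun _ _ _ _ h ↦ Nat.eq_of_mul_eq_mul_left hp.pos h, add_mul, one_mul,
    charDivisorSum, Finset.mul_sum]
  simp only [Nat.cast_mul, legendreSym.mul]

lemma charDivisorSum_prime_mul {p m : ℕ} (hp : p.Prime) (hm : m ≠ 0) (hpm : ¬ p ∣ m) :
    charDivisorSum (p * m) = (1 + legendreSym 23 p) * charDivisorSum m := by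
  rw [← charDivisorSum_prime_mul_add hp hm, left_eq_add]
  refine Finset.sum_eq_zero fun d hd ↦ ?_
  simp only [Finset.mem_inter, Finset.mem_image, Nat.mem_divisors] at hd
  obtain ⟨⟨hdm, -⟩, e, -, rfl⟩ := hd
  exact absurd (dvd_of_mul_right_dvd hdm) hpm

lemma charDivisorSum_prime_mul_mul {p k : ℕ} (hp : p.Prime) (hk : k ≠ 0) :
    charDivisorSum (p * (p * k)) + legendreSym 23 p * charDivisorSum k =
      (1 + legendreSym 23 p) * charDivisorSum (p * k) := by
  rw [← charDivisorSum_prime_mul_add hp (mul_ne_zero hp.ne_zero hk), add_right_inj]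
  have hinter : (p * k).divisors ∩ (p * k).divisors.image (p * ·) = k.divisors.image (p * ·) := by
    ext d
    simp only [Finset.mem_inter, Finset.mem_image, Nat.mem_divisors]
    constructor
    · rintro ⟨⟨hd, -⟩, e, -, rfl⟩
      exact ⟨e, ⟨Nat.dvd_of_mul_dvd_mul_left hp.pos hd, hk⟩, rfl⟩
    · rintro ⟨e, ⟨he, -⟩, rfl⟩
      have hpk := mul_ne_zero hp.ne_zero hk
      exact ⟨⟨Nat.mul_dvd_mul_left p he, hpk⟩, e, ⟨dvd_mul_of_dvd_right he p, hpk⟩, rfl⟩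
  rw [hinter, Finset.sum_image fun _ _ _ _ h ↦ Nat.eq_of_mul_eq_mul_left hp.pos h, charDivisorSum,
    Finset.mul_sum]
  simp only [Nat.cast_mul, legendreSym.mul]

lemma totalRepCount_eq (n : ℕ) (hn : n ≠ 0) : (totalRepCount n : ℤ) = 2 * charDivisorSum n := by
  induction n using Nat.strong_induction_on with
  | _ n ih =>
  obtain rfl | hn1 := eq_or_ne n 1
  · simp [totalRepCount_one, charDivisorSum]
  obtain ⟨p, hp, m, rfl⟩ := Nat.exists_prime_and_dvd hn1
  have hm : m ≠ 0 := right_ne_zero_of_mul hn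
  have hlt {k : ℕ} (hk : k ≠ 0) : k < p * k :=
    lt_mul_of_one_lt_left (Nat.pos_of_ne_zero hk) hp.one_lt
  have hmul := totalRepCount_prime_mul hp m
  rw [ih m (hlt hm) hm] at hmul
  by_cases hpm : p ∣ m
  · obtain ⟨k, rfl⟩ := hpm
    have hk : k ≠ 0 := right_ne_zero_of_mul hm
    have := charDivisorSum_prime_mul_mul hp hk
    have hI : (totalRepCount k : ℤ) = _ := ih k ((hlt hk).trans (hlt hm)) hk
    rw [totalRepCount] at hI
    rw [Nat.cast_mul p k, repCount_prime_mul_arg hp, repCount_prime_mul_arg hp, hI] at hmul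
    push_cast at hmul ⊢
    linear_combination hmul - 2 * this
  · have hpm' : ¬ (p : ℤ) ∣ m := by exact_mod_cast hpm
    rw [repCount_prime_mul_of_not_dvd hpm', repCount_prime_mul_of_not_dvd hpm'] at hmul
    push_cast
    rw [charDivisorSum_prime_mul hp hm hpm]
    push_cast at hmul
    linear_combination hmul

lemma norm_prod_one_sub_pow_le {x : ℂ} (hx : ‖x‖ < 1) (k n : ℕ) :
    ‖∏ i ∈ Finset.range n, (1 - x ^ (k + i))‖ ≤ Real.exp (1 - ‖x‖)⁻¹ := by
  calc ‖∏ i ∈ Finset.range n, (1 - x ^ (k + i))‖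
      = ∏ i ∈ Finset.range n, ‖1 - x ^ (k + i)‖ := norm_prod _ _
    _ ≤ ∏ i ∈ Finset.range n, Real.exp (‖x‖ ^ i) := by
        refine Finset.prod_le_prod (fun _ _ ↦ norm_nonneg _) fun i _ ↦ ?_
        calc ‖1 - x ^ (k + i)‖ ≤ 1 + ‖x‖ ^ (k + i) := by
              simpa using norm_sub_le 1 (x ^ (k + i))
          _ ≤ ‖x‖ ^ i + 1 := by
              linarith [pow_le_pow_of_le_one (norm_nonneg x) hx.le (Nat.le_add_left i k)]
          _ ≤ _ := Real.add_one_le_exp _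
    _ = Real.exp (∑ i ∈ Finset.range n, ‖x‖ ^ i) := (Real.exp_sum _ _).symm
    _ ≤ _ := by
        gcongr
        rw [← tsum_geometric_of_lt_one (norm_nonneg x) hx]
        exact (summable_geometric_of_lt_one (norm_nonneg x) hx).sum_le_tsum _
          fun _ _ ↦ by positivity

lemma summable_negOnePow_mul_pow_pentagonal {x : ℂ} (hx : ‖x‖ < 1) :
    Summable fun k : ℤ ↦ (Int.negOnePow k : ℂ) * x ^ pentagonal k := by
  refine Summable.of_norm ?_
  have h : (fun k : ℤ ↦ ‖(Int.negOnePow k : ℂ) * x ^ pentagonal k‖) =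
      (fun n : ℕ ↦ ‖x‖ ^ n) ∘ pentagonal := by
    ext k
    rcases Int.even_or_odd k with h | h <;> simp [Int.negOnePow_even, Int.negOnePow_odd, h]
  rw [h]
  exact (summable_geometric_of_lt_one (norm_nonneg x) hx).comp_injective pentagonal_injective

/-- Euler's pentagonal number theorem for complex numbers in the open unit disc. -/
theorem tprod_one_sub_pow_eq_tsum_pentagonal {x : ℂ} (hx : ‖x‖ < 1) :
    ∏' n : ℕ, (1 - x ^ (n + 1)) = ∑' k : ℤ, (Int.negOnePow k : ℂ) * x ^ pentagonal k := by
  have h := (summable_negOnePow_mul_pow_pentagonal hx).hasSum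
  rw [← neg_injective.hasSum_iff (fun x hx ↦ by absurd hx; use -x; simp)] at h
  have h2 : HasSum (fun k : ℕ ↦ (-1) ^ k * (x ^ pentagonal (-k) - x ^ pentagonal (k + 1)))
      (∑' k : ℤ, (Int.negOnePow k : ℂ) * x ^ pentagonal k) := by
    convert h.nat_add_neg_add_one using 2 with k
    simp_rw [Function.comp_apply, neg_neg, Int.negOnePow_add]
    simp
    ring
  have hbound (k n : ℕ) : ‖x ^ ((k + 1) * n) * ∏ i ∈ Finset.range (n + 1), (1 - x ^ (k + i + 1))‖
      ≤ ‖x‖ ^ n * Real.exp (1 - ‖x‖)⁻¹ := by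
    rw [norm_mul, norm_pow]
    refine mul_le_mul ?_ ?_ (norm_nonneg _) (by positivity)
    · exact pow_le_pow_of_le_one (norm_nonneg x) hx.le (by nlinarith)
    · simpa only [add_right_comm k 1] using norm_prod_one_sub_pow_le hx (k + 1) (n + 1)
  have hgeom : Summable fun n ↦ ‖x‖ ^ n * Real.exp (1 - ‖x‖)⁻¹ :=
    (summable_geometric_of_lt_one (norm_nonneg x) hx).mul_right _
  rw [← h2.tsum_eq]
  refine Pentagonal.tprod_one_sub_pow ?_ ?_ ?_ h2.summable ?_
  · exact tendsto_pow_atTop_nhds_zero_of_norm_lt_one hx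
  · exact fun k ↦ Summable.of_norm_bounded hgeom (hbound k)
  · intro k
    simp_rw [sub_eq_add_neg]
    refine multipliable_one_add_of_summable ?_
    simp only [norm_neg, norm_pow]
    exact (summable_nat_add_iff (k + 1)).2 (summable_geometric_of_lt_one (norm_nonneg x) hx)
  · refine squeeze_zero_norm (a := fun k ↦ ‖x‖ ^ k *
      ∑' n, ‖x‖ ^ n * Real.exp (1 - ‖x‖)⁻¹) (fun k ↦ ?_) ?_
    · simp only [norm_mul, norm_pow, norm_neg, norm_one, one_pow, one_mul]
      refine mul_le_mul ?_ ?_ (norm_nonneg _) (by positivity)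
      · refine pow_le_pow_of_le_one (norm_nonneg x) hx.le ?_
        rw [Nat.le_div_iff_mul_le two_pos]
        nlinarith
      · exact tsum_of_norm_bounded hgeom.hasSum (hbound k)
    · simpa using (tendsto_pow_atTop_nhds_zero_of_lt_one (norm_nonneg x) hx).mul_const _

lemma tsum_int_eq_sum_tsum (N : ℕ) [NeZero N] {f : ℤ → ℂ} (hf : Summable f) :
    ∑' n, f n = ∑ r : Fin N, ∑' l : ℤ, f (l * N + (r : ℕ)) := by
  have hs : Summable fun v : ℤ × Fin N ↦ f (v.1 * N + (v.2 : ℕ)) :=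
    (Int.divModEquiv N).symm.summable_iff.2 hf
  rw [← (Int.divModEquiv N).symm.tsum_eq]
  exact (hs.tsum_prod.trans (Summable.tsum_comm hs.prod_symm)).trans (tsum_fintype _)

lemma tsum_int_eq_tsum_even_add_tsum_odd {f : ℤ → ℂ} (hf : Summable f) (c : ℤ) :
    ∑' n, f n = ∑' l : ℤ, f (2 * l + c) + ∑' l : ℤ, f (2 * l + c + 1) := by
  have hf' : Summable fun n ↦ f (Equiv.addRight c n) := (Equiv.addRight c).summable_iff.2 hf
  rw [← (Equiv.addRight c).tsum_eq, tsum_int_eq_sum_tsum 2 hf', Fin.sum_univ_two]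
  congr 1 <;> refine tsum_congr fun l ↦ congrArg f ?_ <;> simp <;> ring

lemma summable_pow_natAbs {r : ℝ} (hr₀ : 0 ≤ r) (hr : r < 1) :
    Summable fun n : ℤ ↦ r ^ n.natAbs :=
  .of_nat_of_neg (by simpa using summable_geometric_of_lt_one hr₀ hr)
    (by simpa using summable_geometric_of_lt_one hr₀ hr)

lemma norm_zpow_le {q : ℂ} (hq₀ : q ≠ 0) (hq : ‖q‖ < 1) {m c : ℤ} {k : ℕ} (h : k ≤ m + c) :
    ‖q ^ m‖ ≤ ‖q‖ ^ (-c) * ‖q‖ ^ k := by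
  have hpos : 0 < ‖q‖ := norm_pos_iff.2 hq₀
  rw [norm_zpow, ← zpow_natCast, ← zpow_add₀ hpos.ne']
  exact zpow_le_zpow_right_of_le_one₀ hpos hq.le (by omega)

lemma summable_zpow_int {q : ℂ} (hq₀ : q ≠ 0) (hq : ‖q‖ < 1) {F : ℤ → ℤ} (c : ℤ)
    (hF : ∀ x, |x| ≤ F x + c) : Summable fun x ↦ q ^ F x := by
  refine .of_norm_bounded ((summable_pow_natAbs (norm_nonneg q) hq).mul_left (‖q‖ ^ (-c)))
    fun x ↦ norm_zpow_le hq₀ hq ?_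
  rw [Int.natCast_natAbs]
  exact hF x

lemma summable_zpow_int_prod {q : ℂ} (hq₀ : q ≠ 0) (hq : ‖q‖ < 1) {F : ℤ × ℤ → ℤ} (c : ℤ)
    (hF : ∀ v, |v.1| + |v.2| ≤ F v + c) : Summable fun v ↦ q ^ F v := by
  have hs := summable_pow_natAbs (norm_nonneg q) hq
  refine .of_norm_bounded ((hs.mul_of_nonneg hs (fun _ ↦ by positivity)
    fun _ ↦ by positivity).mul_left (‖q‖ ^ (-c))) fun v ↦ ?_
  rw [← pow_add]
  refine norm_zpow_le hq₀ hq ?_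
  rw [Nat.cast_add, Int.natCast_natAbs, Int.natCast_natAbs]
  exact hF v

lemma summable_thetaOne {q : ℂ} (hq₀ : q ≠ 0) (hq : ‖q‖ < 1) :
    Summable fun v : ℤ × ℤ ↦ q ^ (1 * v.1 ^ 2 + 1 * v.1 * v.2 + 6 * v.2 ^ 2) := by
  refine summable_zpow_int_prod hq₀ hq 4 fun ⟨x, y⟩ ↦ ?_
  rcases abs_cases x with ⟨hx, -⟩ | ⟨hx, -⟩ <;> rcases abs_cases y with ⟨hy, -⟩ | ⟨hy, -⟩ <;>
    simp only [hx, hy] <;>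
    nlinarith [sq_nonneg (2 * x + y - 2), sq_nonneg (2 * x + y + 2), sq_nonneg (y - 1),
      sq_nonneg (y + 1), sq_nonneg y]

lemma summable_thetaTwo {q : ℂ} (hq₀ : q ≠ 0) (hq : ‖q‖ < 1) :
    Summable fun v : ℤ × ℤ ↦ q ^ (2 * v.1 ^ 2 + 1 * v.1 * v.2 + 3 * v.2 ^ 2) := by
  refine summable_zpow_int_prod hq₀ hq 4 fun ⟨x, y⟩ ↦ ?_
  rcases abs_cases x with ⟨hx, -⟩ | ⟨hx, -⟩ <;> rcases abs_cases y with ⟨hy, -⟩ | ⟨hy, -⟩ <;>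
    simp only [hx, hy] <;>
    nlinarith [sq_nonneg (x + y), sq_nonneg (x - y), sq_nonneg (x - 1), sq_nonneg (x + 1),
      sq_nonneg (y - 1), sq_nonneg (y + 1), sq_nonneg y]

/-- The theta series of the binary quadratic form `a x² + b x y + c y²`. -/
def binaryTheta (a b c : ℤ) (q : ℂ) : ℂ :=
  ∑' v : ℤ × ℤ, q ^ (a * v.1 ^ 2 + b * v.1 * v.2 + c * v.2 ^ 2)

lemma natCast_triangular (n : ℕ) : ((n * (n + 1) / 2 : ℕ) : ℤ) = (n : ℤ) * (n + 1) / 2 := by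
  push_cast; rfl

lemma two_mul_triangular (n : ℤ) : 2 * (n * (n + 1) / 2) = n * (n + 1) :=
  Int.mul_ediv_cancel' (Int.even_mul_succ_self n).two_dvd

lemma triangular_neg (n : ℤ) : -(n + 1) * (-(n + 1) + 1) / 2 = n * (n + 1) / 2 := by
  congr 1; ring

lemma summable_triangular {q : ℂ} (hq₀ : q ≠ 0) (hq : ‖q‖ < 1) :
    Summable fun n : ℤ ↦ q ^ (n * (n + 1) / 2) := by
  refine summable_zpow_int hq₀ hq 5 fun x ↦ ?_
  have := two_mul_triangular x
  rcases abs_cases x with ⟨hx, -⟩ | ⟨hx, -⟩ <;> rw [hx] <;>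
    nlinarith [sq_nonneg (x - 1), sq_nonneg (x + 1), sq_nonneg (x + 2)]

lemma two_mul_tsum_triangular {q : ℂ} (hq₀ : q ≠ 0) (hq : ‖q‖ < 1) :
    2 * ∑' n : ℕ, q ^ (n * (n + 1) / 2) = ∑' n : ℤ, q ^ (n * (n + 1) / 2) := by
  have hs := summable_triangular hq₀ hq
  have hs₁ : Summable fun n : ℕ ↦ q ^ ((n : ℤ) * (n + 1) / 2) :=
    hs.comp_injective Nat.cast_injective
  rw [tsum_of_nat_of_neg_add_one (f := fun n : ℤ ↦ q ^ (n * (n + 1) / 2)) hs₁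
    (by simpa only [triangular_neg] using hs₁)]
  simp only [triangular_neg, ← natCast_triangular, zpow_natCast, two_mul]

lemma tsum_triangular_eq {q : ℂ} (hq₀ : q ≠ 0) (hq : ‖q‖ < 1) (n : ℤ) :
    q ^ 3 * ((q ^ 23) ^ (n * (n + 1) / 2) * ∑' m : ℤ, q ^ (m * (m + 1) / 2)) =
      2 * ∑' x : ℤ, q ^ (2 * x ^ 2 + 1 * x * (2 * n + 1) + 3 * (2 * n + 1) ^ 2) := by
  rw [tsum_int_eq_tsum_even_add_tsum_odd (summable_triangular hq₀ hq) n,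
    ← ((Equiv.subLeft (-1 - n)).tsum_eq fun l : ℤ ↦
      q ^ ((2 * l + n + 1) * (2 * l + n + 1 + 1) / 2))]
  have h (l : ℤ) : (2 * (Equiv.subLeft (-1 - n) l) + n + 1) *
      (2 * (Equiv.subLeft (-1 - n) l) + n + 1 + 1) = (2 * l + n) * (2 * l + n + 1) := by
    simp only [Equiv.subLeft_apply]; ring
  simp only [h]
  rw [← two_mul, mul_left_comm _ 2, mul_left_comm _ 2, ← tsum_mul_left, ← tsum_mul_left]
  congr 1
  refine tsum_congr fun l ↦ ?_
  rw [← zpow_natCast, ← zpow_natCast, ← zpow_mul, ← zpow_add₀ hq₀, ← zpow_add₀ hq₀]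
  congr 1
  have h₁ := two_mul_triangular n
  have h₂ := two_mul_triangular (2 * l + n)
  push_cast
  linarith

lemma two_mul_triangular_mul_triangular {q : ℂ} (hq₀ : q ≠ 0) (hq : ‖q‖ < 1) :
    2 * (q ^ 3 * (∑' n : ℕ, q ^ (n * (n + 1) / 2)) * ∑' n : ℕ, (q ^ 23) ^ (n * (n + 1) / 2)) =
      binaryTheta 2 1 3 q - binaryTheta 1 1 6 (q ^ 2) := by
  have hq' : ‖q ^ 23‖ < 1 := by
    rw [norm_pow]; exact pow_lt_one₀ (norm_nonneg q) hq (by norm_num)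
  have hq₂ : ‖q ^ 2‖ < 1 := by
    rw [norm_pow]; exact pow_lt_one₀ (norm_nonneg q) hq (by norm_num)
  have hs := (summable_thetaTwo hq₀ hq).prod_symm
  have hs' := (summable_thetaOne (pow_ne_zero 2 hq₀) hq₂).prod_symm
  have hodd : 2 * (q ^ 3 * (∑' n : ℕ, q ^ (n * (n + 1) / 2)) *
      ∑' n : ℕ, (q ^ 23) ^ (n * (n + 1) / 2)) =
      ∑' n : ℤ, ∑' x : ℤ, q ^ (2 * x ^ 2 + 1 * x * (2 * n + 1) + 3 * (2 * n + 1) ^ 2) := by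
    have h := tsum_congr (L := .unconditional ℤ) (tsum_triangular_eq hq₀ hq)
    rw [tsum_mul_left, tsum_mul_right, tsum_mul_left, ← two_mul_tsum_triangular hq₀ hq,
      ← two_mul_tsum_triangular (pow_ne_zero 23 hq₀) hq'] at h
    linear_combination h / 2
  have heven : binaryTheta 1 1 6 (q ^ 2) =
      ∑' n : ℤ, ∑' x : ℤ, q ^ (2 * x ^ 2 + 1 * x * (2 * n) + 3 * (2 * n) ^ 2) := by
    rw [binaryTheta, ← (Equiv.prodComm ℤ ℤ).tsum_eq]
    refine hs'.tsum_prod.trans (tsum_congr fun n ↦ tsum_congr fun x ↦ ?_)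
    simp only [Prod.fst_swap, Prod.snd_swap]
    rw [← zpow_natCast, ← zpow_mul]
    congr 1
    push_cast
    ring
  have htwo : binaryTheta 2 1 3 q = ∑' y : ℤ, ∑' x : ℤ, q ^ (2 * x ^ 2 + 1 * x * y + 3 * y ^ 2) := by
    rw [binaryTheta, ← (Equiv.prodComm ℤ ℤ).tsum_eq]
    exact hs.tsum_prod
  have hrows : Summable fun y : ℤ ↦ ∑' x : ℤ, q ^ (2 * x ^ 2 + 1 * x * y + 3 * y ^ 2) := hs.prod
  rw [hodd, heven, htwo, tsum_int_eq_tsum_even_add_tsum_odd hrows 0]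
  simp only [add_zero]
  ring

/-- The `b`-th row of the difference of the theta series of the two forms of
discriminant `-23`, in coordinates in which these rows are symmetric. -/
def thetaRowDiff (q : ℂ) (b : ℤ) : ℂ :=
  ∑' y : ℤ, q ^ (b ^ 2 + b * y + 6 * y ^ 2) - ∑' y : ℤ, q ^ (2 * b ^ 2 + 5 * b * y + 6 * y ^ 2)

lemma thetaRowDiff_neg (q : ℂ) (b : ℤ) : thetaRowDiff q (-b) = thetaRowDiff q b := by
  rw [thetaRowDiff, thetaRowDiff]
  congr 1
  all_goals
    rw [← (Equiv.neg ℤ).tsum_eq]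
    refine tsum_congr fun y ↦ congrArg (q ^ ·) ?_
    simp only [Equiv.neg_apply]
    ring

lemma thetaRowDiff_three_mul (q : ℂ) (c : ℤ) : thetaRowDiff q (3 * c) = 0 := by
  rw [thetaRowDiff, sub_eq_zero, ← (Equiv.addRight c).tsum_eq]
  refine tsum_congr fun y ↦ congrArg (q ^ ·) ?_
  simp only [Equiv.coe_addRight]
  ring

lemma thetaRowDiff_two_mul (q : ℂ) (c : ℤ) : thetaRowDiff q (2 * c) = 0 := by
  rw [thetaRowDiff, sub_eq_zero, ← (Equiv.subLeft (-c)).tsum_eq]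
  refine tsum_congr fun y ↦ congrArg (q ^ ·) ?_
  simp only [Equiv.subLeft_apply]
  ring

/-- The shear `(b, y) ↦ (b + y, y)` of `ℤ × ℤ`. -/
def shear : ℤ × ℤ ≃ ℤ × ℤ where
  toFun v := (v.1 + v.2, v.2)
  invFun v := (v.1 - v.2, v.2)
  left_inv v := by simp
  right_inv v := by simp

lemma HasSum.tsum_shear {f : ℤ × ℤ → ℂ} {a : ℂ} (hf : HasSum f a) :
    HasSum (fun b : ℤ ↦ ∑' y : ℤ, f (b + y, y)) a := by
  have h : HasSum (f ∘ shear) a := shear.hasSum_iff.2 hf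
  have h' := h.summable.prod.hasSum
  rwa [← h.summable.tsum_prod, h.tsum_eq] at h'

lemma hasSum_thetaRowDiff {q : ℂ} (hq₀ : q ≠ 0) (hq : ‖q‖ < 1) :
    HasSum (thetaRowDiff q) (binaryTheta 1 1 6 q - binaryTheta 2 1 3 q) := by
  have h₁ : HasSum (fun b : ℤ ↦ ∑' y : ℤ, q ^ (b ^ 2 + b * y + 6 * y ^ 2))
      (binaryTheta 1 1 6 q) := by
    have hs := summable_thetaOne hq₀ hq
    have h := hs.prod.hasSum
    rw [← hs.tsum_prod] at h
    simpa only [one_mul, binaryTheta] using h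
  have h₂ : HasSum (fun b : ℤ ↦ ∑' y : ℤ, q ^ (2 * b ^ 2 + 5 * b * y + 6 * y ^ 2))
      (binaryTheta 2 1 3 q) := by
    rw [binaryTheta]
    convert (summable_thetaTwo hq₀ hq).hasSum.tsum_shear using 5
    ring
  exact h₁.sub h₂

lemma binaryTheta_sub_eq_tsum {q : ℂ} (hq₀ : q ≠ 0) (hq : ‖q‖ < 1) :
    binaryTheta 1 1 6 q - binaryTheta 2 1 3 q = 2 * ∑' l : ℤ, thetaRowDiff q (6 * l - 1) := by
  have hs := hasSum_thetaRowDiff hq₀ hq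
  have h₀ (l : ℤ) : thetaRowDiff q (l * 6) = 0 := by
    rw [← thetaRowDiff_two_mul q (3 * l)]; congr 1; ring
  have h₂ (l : ℤ) : thetaRowDiff q (l * 6 + 2) = 0 := by
    rw [← thetaRowDiff_two_mul q (3 * l + 1)]; congr 1; ring
  have h₃ (l : ℤ) : thetaRowDiff q (l * 6 + 3) = 0 := by
    rw [← thetaRowDiff_three_mul q (2 * l + 1)]; congr 1; ring
  have h₄ (l : ℤ) : thetaRowDiff q (l * 6 + 4) = 0 := by
    rw [← thetaRowDiff_two_mul q (3 * l + 2)]; congr 1; ring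
  have h₁ : ∑' l : ℤ, thetaRowDiff q (l * 6 + 1) = ∑' l : ℤ, thetaRowDiff q (6 * l - 1) := by
    rw [← (Equiv.neg ℤ).tsum_eq]
    refine tsum_congr fun l ↦ ?_
    rw [← thetaRowDiff_neg]
    congr 1
    simp only [Equiv.neg_apply]
    ring
  have h₅ : ∑' l : ℤ, thetaRowDiff q (l * 6 + 5) = ∑' l : ℤ, thetaRowDiff q (6 * l - 1) := by
    rw [← (Equiv.addRight (-1 : ℤ)).tsum_eq]
    refine tsum_congr fun l ↦ congrArg (thetaRowDiff q) ?_
    simp only [Equiv.coe_addRight]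
    ring
  rw [← hs.tsum_eq, tsum_int_eq_sum_tsum 6 hs.summable]
  simp [Fin.sum_univ_succ, h₀, h₁, h₂, h₃, h₄, h₅, two_mul]

lemma negOnePow_mul_tsum_pentagonal {q : ℂ} (hq : ‖q‖ < 1) (l : ℤ) :
    q * ((Int.negOnePow l : ℂ) * (q ^ 23) ^ pentagonal l *
      ∑' k : ℤ, (Int.negOnePow k : ℂ) * q ^ pentagonal k) = thetaRowDiff q (6 * l - 1) := by
  rw [tsum_int_eq_tsum_even_add_tsum_odd (summable_negOnePow_mul_pow_pentagonal hq) l,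
    ← (Equiv.subLeft (-(3 * l))).tsum_eq fun y : ℤ ↦
      (Int.negOnePow (2 * y + l + 1) : ℂ) * q ^ pentagonal (2 * y + l + 1),
    thetaRowDiff, mul_add, mul_add, sub_eq_add_neg, ← tsum_neg]
  simp only [← tsum_mul_left]
  have hl : ((Int.negOnePow l : ℂ)) * (Int.negOnePow l : ℂ) = 1 := by
    rw [← Int.cast_mul, ← Units.val_mul, Int.units_mul_self, Units.val_one, Int.cast_one]
  congr 1
  · refine tsum_congr fun y ↦ ?_
    have hsign : Int.negOnePow (2 * y + l) = Int.negOnePow l := by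
      rw [Int.negOnePow_add, Int.negOnePow_two_mul, one_mul]
    have hexp : q * ((q ^ 23) ^ pentagonal l * q ^ pentagonal (2 * y + l)) =
        q ^ ((6 * l - 1) ^ 2 + (6 * l - 1) * y + 6 * y ^ 2) := by
      rw [← pow_mul, ← pow_add, ← pow_succ', ← zpow_natCast]
      congr 1
      have h₁ := two_mul_natCast_pentagonal l
      have h₂ := two_mul_natCast_pentagonal (2 * y + l)
      push_cast
      linarith
    rw [hsign, ← hexp]
    linear_combination q * ((q ^ 23) ^ pentagonal l * q ^ pentagonal (2 * y + l)) * hl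
  · refine tsum_congr fun y ↦ ?_
    have hsign : Int.negOnePow (2 * (Equiv.subLeft (-(3 * l)) y) + l + 1) = -Int.negOnePow l := by
      rw [Int.negOnePow_succ, Int.negOnePow_add, Int.negOnePow_two_mul, one_mul]
    have hexp : q * ((q ^ 23) ^ pentagonal l *
        q ^ pentagonal (2 * (Equiv.subLeft (-(3 * l)) y) + l + 1)) =
        q ^ (2 * (6 * l - 1) ^ 2 + 5 * (6 * l - 1) * y + 6 * y ^ 2) := by
      rw [← pow_mul, ← pow_add, ← pow_succ', ← zpow_natCast]
      congr 1
      have h₁ := two_mul_natCast_pentagonal l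
      have h₂ := two_mul_natCast_pentagonal (2 * (Equiv.subLeft (-(3 * l)) y) + l + 1)
      simp only [Equiv.subLeft_apply] at h₂ ⊢
      push_cast
      linarith
    rw [hsign, ← hexp]
    push_cast
    linear_combination -(q * ((q ^ 23) ^ pentagonal l *
      q ^ pentagonal (2 * (Equiv.subLeft (-(3 * l)) y) + l + 1))) * hl

lemma binaryTheta_sub_eq_tprod {q : ℂ} (hq₀ : q ≠ 0) (hq : ‖q‖ < 1) :
    binaryTheta 1 1 6 q - binaryTheta 2 1 3 q =
      2 * (q * ∏' n : ℕ, ((1 - q ^ (1 * (n + 1))) * (1 - q ^ (23 * (n + 1))))) := by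
  have hq' : ‖q ^ 23‖ < 1 := by
    rw [norm_pow]; exact pow_lt_one₀ (norm_nonneg q) hq (by norm_num)
  simp only [one_mul, pow_mul]
  rw [Multipliable.tprod_mul (ModularForm.multipliable_one_sub_pow hq) (ModularForm.multipliable_one_sub_pow hq'),
    tprod_one_sub_pow_eq_tsum_pentagonal hq, tprod_one_sub_pow_eq_tsum_pentagonal hq',
    binaryTheta_sub_eq_tsum hq₀ hq, mul_comm (∑' _, _ * q ^ _),
    ← tsum_mul_right, ← tsum_mul_left (a := q)]
  congr 1
  exact tsum_congr fun l ↦ (negOnePow_mul_tsum_pentagonal hq l).symm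

lemma hasSum_repCount {a b c : ℤ} (hpos : ∀ x y : ℤ, 0 ≤ a * x ^ 2 + b * x * y + c * y ^ 2) {q : ℂ}
    (hs : Summable fun v : ℤ × ℤ ↦ q ^ (a * v.1 ^ 2 + b * v.1 * v.2 + c * v.2 ^ 2)) :
    HasSum (fun n : ℕ ↦ (repCount a b c n : ℂ) * q ^ n) (binaryTheta a b c q) := by
  have h := hs.hasSum.tsum_fiberwise
    fun v : ℤ × ℤ ↦ (a * v.1 ^ 2 + b * v.1 * v.2 + c * v.2 ^ 2).toNat
  refine h.congr_fun fun n ↦ ?_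
  have hset : (fun v : ℤ × ℤ ↦ (a * v.1 ^ 2 + b * v.1 * v.2 + c * v.2 ^ 2).toNat) ⁻¹' {n} =
      repSet a b c n := by
    ext v
    have := hpos v.1 v.2
    simp only [Set.mem_preimage, Set.mem_singleton_iff, repSet, Set.mem_ofPred_eq]
    omega
  have hconst (v : repSet a b c n) :
      q ^ (a * v.1.1 ^ 2 + b * v.1.1 * v.1.2 + c * v.1.2 ^ 2) = q ^ n := by
    have hv := v.2
    simp only [repSet, Set.mem_ofPred_eq] at hv
    rw [hv, zpow_natCast]
  rw [hset, tsum_congr hconst, tsum_const, nsmul_eq_mul, repCount, Nat.card_coe_set_eq]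

lemma repCount_zero {a b c : ℤ} (ha : 0 < a) (hd : b ^ 2 - 4 * a * c = -23) :
    repCount a b c 0 = 1 := by
  rw [repCount, Set.ncard_eq_one]
  refine ⟨(0, 0), ?_⟩
  ext ⟨x, y⟩
  simp only [repSet, Set.mem_ofPred_eq, Set.mem_singleton_iff, Prod.mk.injEq]
  constructor
  · intro h
    have h' : (2 * a * x + b * y) ^ 2 + 23 * y ^ 2 = 0 := by
      linear_combination 4 * a * h + y ^ 2 * hd
    have hy : y = 0 :=
      pow_eq_zero_iff two_ne_zero |>.1 (by nlinarith [sq_nonneg (2 * a * x + b * y), sq_nonneg y])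
    subst hy
    simpa [ha.ne'] using h
  · rintro ⟨rfl, rfl⟩
    ring

lemma norm_legendreSym_le_one (a : ℤ) : ‖(legendreSym 23 a : ℂ)‖ ≤ 1 := by
  by_cases h : (a : ZMod 23) = 0
  · simp [(legendreSym.eq_zero_iff 23 a).2 h]
  · rcases legendreSym.eq_one_or_neg_one 23 h with h | h <;> simp [h]

lemma summable_legendreSym_mul_pow {q : ℂ} (hq : ‖q‖ < 1) :
    Summable fun v : ℕ+ × ℕ+ ↦ (legendreSym 23 (v.1 : ℕ) : ℂ) * q ^ (v.1 * v.2 : ℕ) := by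
  have h := (summable_prod_mul_pow 0 hq).norm
  simp only [pow_zero, one_mul] at h
  refine .of_norm_bounded h fun v ↦ ?_
  rw [norm_mul]
  exact mul_le_of_le_one_left (norm_nonneg _) (norm_legendreSym_le_one _)

lemma tsum_legendreSym_mul_pow {q : ℂ} (hq : ‖q‖ < 1) :
    ∑' v : ℕ+ × ℕ+, (legendreSym 23 (v.1 : ℕ) : ℂ) * q ^ (v.1 * v.2 : ℕ) =
      ∑' n : ℕ, (charDivisorSum (n + 1) : ℂ) * q ^ (n + 1) := by
  have hs := sigmaAntidiagonalEquivProd.summable_iff.2 (summable_legendreSym_mul_pow hq)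
  rw [← sigmaAntidiagonalEquivProd.tsum_eq, ← tsum_pnat_eq_tsum_succ
    (f := fun n ↦ (charDivisorSum n : ℂ) * q ^ n)]
  refine hs.tsum_sigma.trans (tsum_congr fun n ↦ ?_)
  rw [tsum_fintype]
  have h := (n : ℕ).divisorsAntidiagonal.sum_attach
    fun x : ℕ × ℕ ↦ (legendreSym 23 x.1 : ℂ) * q ^ (x.1 * x.2)
  refine h.trans ?_
  rw [Nat.sum_divisorsAntidiagonal fun x y ↦ (legendreSym 23 x : ℂ) * q ^ (x * y), charDivisorSum,
    Int.cast_sum, Finset.sum_mul]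
  refine Finset.sum_congr rfl fun d hd ↦ ?_
  rw [Nat.mul_div_cancel' (Nat.dvd_of_mem_divisors hd)]

lemma hasSum_lambert {q : ℂ} (hq : ‖q‖ < 1) :
    HasSum (fun j : ℕ ↦ (legendreSym 23 ((j : ℤ) + 1) : ℂ) * (q ^ (j + 1) / (1 - q ^ (j + 1))))
      (∑' n : ℕ, (charDivisorSum (n + 1) : ℂ) * q ^ (n + 1)) := by
  have hs := summable_legendreSym_mul_pow hq
  have h := hs.prod.hasSum
  rw [← hs.tsum_prod, tsum_legendreSym_mul_pow hq] at h
  have hrow (a : ℕ+) : ∑' b : ℕ+, (legendreSym 23 (a : ℕ) : ℂ) * q ^ (a * b : ℕ) =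
      (legendreSym 23 (a : ℕ) : ℂ) * (q ^ (a : ℕ) / (1 - q ^ (a : ℕ))) := by
    have hqa : ‖q ^ (a : ℕ)‖ < 1 := by
      rw [norm_pow]; exact pow_lt_one₀ (norm_nonneg q) hq a.ne_zero
    simp only [pow_mul]
    rw [tsum_mul_left, div_eq_mul_inv, ← tsum_geometric_of_norm_lt_one hqa,
      ← tsum_mul_left (a := q ^ (a : ℕ)),
      tsum_pnat_eq_tsum_succ (f := fun m ↦ (q ^ (a : ℕ)) ^ m)]
    simp only [pow_succ']
  rw [funext hrow, ← Equiv.pnatEquivNat.symm.hasSum_iff] at h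
  refine h.congr_fun fun j ↦ ?_
  simp

lemma binaryTheta_add {q : ℂ} (hq₀ : q ≠ 0) (hq : ‖q‖ < 1) :
    binaryTheta 1 1 6 q + 2 * binaryTheta 2 1 3 q =
      3 + 2 * ∑' j : ℕ, (legendreSym 23 ((j : ℤ) + 1) : ℂ) * (q ^ (j + 1) / (1 - q ^ (j + 1))) := by
  have h₁ := hasSum_repCount (fun x y ↦ by nlinarith [sq_nonneg (2 * x + y), sq_nonneg y])
    (summable_thetaOne hq₀ hq)
  have h₂ := hasSum_repCount (fun x y ↦ by nlinarith [sq_nonneg (4 * x + y), sq_nonneg y])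
    (summable_thetaTwo hq₀ hq)
  have h := h₁.add (h₂.mul_left 2)
  rw [(hasSum_lambert hq).tsum_eq, ← h.tsum_eq, h.summable.tsum_eq_zero_add, ← tsum_mul_left]
  congr 1
  · simp only [Nat.cast_zero, repCount_zero (a := 1) (b := 1) (c := 6) (by norm_num) (by norm_num),
      repCount_zero (a := 2) (b := 1) (c := 3) (by norm_num) (by norm_num)]
    norm_num
  · refine tsum_congr fun n ↦ ?_
    have := congrArg (Int.cast (R := ℂ)) (totalRepCount_eq (n + 1) n.succ_ne_zero)
    rw [totalRepCount] at this
    push_cast at this ⊢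
    linear_combination q ^ (n + 1) * this

theorem statement19 (q : ℂ) (hq : ‖q‖ < 1) :
    q ^ 3 * (∑' n : ℕ, (q) ^ (n * (n + 1) / 2)) * (∑' n : ℕ, (q ^ 23) ^ (n * (n + 1) / 2)) =
      (1 / 3) * (∑' j : ℕ, (legendreSym 23 ((j : ℤ) + 1) : ℂ) * (q ^ (1 * (j + 1)) / (1 - q ^ (1 * (j + 1))) - q ^ (2 * (j + 1)) / (1 - q ^ (2 * (j + 1)))))
        - (1 / 3) * (q * ∏' n : ℕ, ((1 - q ^ (1 * (n + 1))) * (1 - q ^ (23 * (n + 1))))) - (2 / 3) * (q ^ 2 * ∏' n : ℕ, ((1 - q ^ (2 * (n + 1))) * (1 - q ^ (46 * (n + 1))))) := by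
  obtain rfl | hq₀ := eq_or_ne q 0
  · simp
  have hq₂ : ‖q ^ 2‖ < 1 := by
    rw [norm_pow]; exact pow_lt_one₀ (norm_nonneg q) hq (by norm_num)
  have hq₂₀ := pow_ne_zero 2 hq₀
  have hprod : ∏' n : ℕ, ((1 - q ^ (2 * (n + 1))) * (1 - q ^ (46 * (n + 1)))) =
      ∏' n : ℕ, ((1 - (q ^ 2) ^ (1 * (n + 1))) * (1 - (q ^ 2) ^ (23 * (n + 1)))) := by
    simp only [← pow_mul, one_mul, ← mul_assoc, Nat.reduceMul]
  have hlambert := ((hasSum_lambert hq).sub (hasSum_lambert hq₂)).tsum_eq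
  rw [← (hasSum_lambert hq).tsum_eq, ← (hasSum_lambert hq₂).tsum_eq] at hlambert
  simp only [← mul_sub] at hlambert
  rw [hprod]
  have h₁ := binaryTheta_sub_eq_tprod hq₀ hq
  have h₂ := binaryTheta_sub_eq_tprod hq₂₀ hq₂
  simp only [one_mul, pow_mul q 2] at h₁ h₂ ⊢
  rw [hlambert]
  linear_combination (1 / 2) * two_mul_triangular_mul_triangular hq₀ hq
    - (1 / 6) * h₁ - (1 / 3) * h₂
    + (1 / 6) * binaryTheta_add hq₀ hq - (1 / 6) * binaryTheta_add hq₂₀ hq₂
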